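/- For every integer n ≥ 1, every 0 ≤ s < r, and every y, z ∈ ℝ: ∫_{s < r_n < ⋯ < r_1 < r} ∫_{ℝⁿ} p_{r−r_1}(z−z_1)²·p_{r_1−r_2}(z_1−z_2)²·⋯·p_{r_{n−1}−r_n}(z_{n−1}−z_n)²·p_{r_n−s}(z_n−y)² dz_n ⋯ dz_1 dr_n ⋯ dr_1 = ( (r−s)^{(n−1)/2} / ( 2^{n+1} · Γ((n+1)/2) ) ) · p_{(r−s)/2}(z−y), where Γ denotes the Gamma function. -/

import Mathlib

open MeasureTheory

/-- The one-dimensional heat kernel `p_t(x) = (2πt)^{-1/2} exp(-x²/(2t))`. -/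
noncomputable def heatKernel (t x : ℝ) : ℝ :=
  (Real.sqrt (2 * Real.pi * t))⁻¹ * Real.exp (-x ^ 2 / (2 * t))

open scoped ENNReal

lemma heatKernel_nonneg (t x : ℝ) : 0 ≤ heatKernel t x := by
  unfold heatKernel
  positivity

lemma heatKernel_of_nonpos {t : ℝ} (ht : t ≤ 0) (x : ℝ) : heatKernel t x = 0 := by
  have h : 2 * Real.pi * t ≤ 0 := mul_nonpos_of_nonneg_of_nonpos (by positivity) ht
  simp [heatKernel, Real.sqrt_eq_zero_of_nonpos h]

@[fun_prop]
lemma Measurable.heatKernel {α : Type*} [MeasurableSpace α] {f g : α → ℝ}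
    (hf : Measurable f) (hg : Measurable g) : Measurable fun a => heatKernel (f a) (g a) := by
  unfold _root_.heatKernel
  fun_prop

lemma heatKernel_sq {t : ℝ} (ht : 0 < t) (x : ℝ) :
    heatKernel t x ^ 2 = (2 * √Real.pi)⁻¹ * t ^ (-(1 / 2) : ℝ) * heatKernel (t / 2) x := by
  have hsq : √(2 * Real.pi * t) ^ 2 = 2 * Real.pi * t := Real.sq_sqrt (by positivity)
  have hhalf : √(2 * Real.pi * (t / 2)) = √Real.pi * √t := by
    rw [← Real.sqrt_mul Real.pi_pos.le]
    congr 1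
    ring
  have hpi : √Real.pi ^ 2 = Real.pi := Real.sq_sqrt Real.pi_pos.le
  have ht2 : √t ^ 2 = t := Real.sq_sqrt ht.le
  have hexp : Real.exp (-x ^ 2 / (2 * t)) ^ 2 = Real.exp (-x ^ 2 / (2 * (t / 2))) := by
    rw [← Real.exp_nat_mul]
    congr 1
    push_cast
    field_simp
  rw [heatKernel, heatKernel, mul_pow, hexp, inv_pow, hsq, hhalf, Real.rpow_neg ht.le,
    ← Real.sqrt_eq_rpow, ← mul_assoc, ← mul_inv, ← mul_inv]
  congr 2
  linear_combination (-2 * t) * hpi - 2 * √Real.pi ^ 2 * ht2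

lemma lintegral_heatKernel_sub {t : ℝ} (ht : 0 < t) (c : ℝ) :
    ∫⁻ x, ENNReal.ofReal (heatKernel t (x - c)) = 1 := by
  lift t to NNReal using ht.le
  exact ProbabilityTheory.lintegral_gaussianPDFReal_eq_one c (by exact_mod_cast ht.ne')

/-- Completing the square in a product of two heat kernels. -/
lemma heatKernel_mul_heatKernel {a b : ℝ} (ha : 0 < a) (hb : 0 < b) (x w y : ℝ) :
    heatKernel a (x - w) * heatKernel b (w - y) =
      heatKernel (a + b) (x - y) *
        heatKernel (a * b / (a + b)) (w - (b * x + a * y) / (a + b)) := by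
  unfold heatKernel
  rw [mul_mul_mul_comm, mul_mul_mul_comm (√(2 * Real.pi * (a + b)))⁻¹, ← Real.exp_add,
    ← Real.exp_add, ← mul_inv, ← mul_inv, ← Real.sqrt_mul (by positivity),
    ← Real.sqrt_mul (by positivity)]
  congr 1
  · congr 2
    field_simp
  · congr 1
    field_simp
    ring

lemma lintegral_heatKernel_mul_heatKernel {a b : ℝ} (ha : 0 < a) (hb : 0 < b) (x y : ℝ) :
    ∫⁻ w, ENNReal.ofReal (heatKernel a (x - w) * heatKernel b (w - y)) =
      ENNReal.ofReal (heatKernel (a + b) (x - y)) := by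
  simp_rw [heatKernel_mul_heatKernel ha hb, ENNReal.ofReal_mul (heatKernel_nonneg _ _)]
  rw [lintegral_const_mul _ (by fun_prop), lintegral_heatKernel_sub (by positivity), mul_one]

/-- The Beta integral over an arbitrary bounded interval. -/
lemma lintegral_rpow_mul_rpow {a b : ℝ} (ha : 0 < a) (hb : 0 < b) {s r : ℝ} (hsr : s < r) :
    ∫⁻ x in Set.Ioo s r, ENNReal.ofReal ((x - s) ^ (a - 1) * (r - x) ^ (b - 1)) =
      ENNReal.ofReal ((r - s) ^ (a + b - 1) * ProbabilityTheory.beta a b) := by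
  have hd : 0 < r - s := sub_pos.2 hsr
  have himage : (fun t => (r - s) * t + s) '' Set.Ioo 0 1 = Set.Ioo s r := by
    rw [Set.image_affine_Ioo hd]
    simp
  have hbeta := ProbabilityTheory.beta_pos ha hb
  rw [← himage, lintegral_image_eq_lintegral_abs_deriv_mul (f' := fun _ => r - s) measurableSet_Ioo
    (fun t _ => by
      simpa using (((hasDerivAt_id t).const_mul (r - s)).add_const s).hasDerivWithinAt)
    (fun t _ t' _ h => by simpa [hd.ne'] using h)]
  have hone := ProbabilityTheory.lintegral_betaPDF_eq_one ha hb
  rw [ProbabilityTheory.lintegral_betaPDF] at hone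
  rw [← mul_one (ENNReal.ofReal (_ * _)), ← hone, ← lintegral_const_mul _ (by fun_prop)]
  refine setLIntegral_congr_fun measurableSet_Ioo fun t ht => ?_
  have ht1 : 0 < 1 - t := sub_pos.2 ht.2
  rw [← ENNReal.ofReal_mul (by positivity), ← ENNReal.ofReal_mul (by positivity), abs_of_pos hd]
  congr 1
  rw [show (r - s) * t + s - s = (r - s) * t by ring,
    show r - ((r - s) * t + s) = (r - s) * (1 - t) by ring,
    Real.mul_rpow hd.le ht.1.le, Real.mul_rpow hd.le ht1.le,
    show a + b - 1 = 1 + (a - 1) + (b - 1) by ring, Real.rpow_add hd, Real.rpow_add hd,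
    Real.rpow_one]
  field_simp

/-- The product of squared heat kernels along the space-time path which starts at `(r, z)`, passes
through the points `(u i, w i)` and ends at `(s, y)`. -/
noncomputable def heatChain (s y : ℝ) :
    (n : ℕ) → ℝ → ℝ → (Fin n → ℝ) → (Fin n → ℝ) → ℝ
  | 0, r, z, _, _ => heatKernel (r - s) (z - y) ^ 2
  | n + 1, r, z, u, w =>
      heatKernel (r - u 0) (z - w 0) ^ 2 * heatChain s y n (u 0) (w 0) (Fin.tail u) (Fin.tail w)

lemma heatChain_nonneg (s y : ℝ) (n : ℕ) (r z : ℝ) (u w : Fin n → ℝ) :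
    0 ≤ heatChain s y n r z u w := by
  induction n generalizing r z with
  | zero => exact sq_nonneg _
  | succ n ih => exact mul_nonneg (sq_nonneg _) (ih _ _ _ _)

@[fun_prop]
lemma Measurable.heatChain {α : Type*} [MeasurableSpace α] (s y : ℝ) {n : ℕ}
    {f g : α → ℝ} {u w : α → Fin n → ℝ} (hf : Measurable f) (hg : Measurable g)
    (hu : Measurable u) (hw : Measurable w) :
    Measurable fun a => heatChain s y n (f a) (g a) (u a) (w a) := by
  induction n generalizing f g with
  | zero =>
    unfold _root_.heatChain
    fun_prop
  | succ n ih =>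
    have htail {v : α → Fin (n + 1) → ℝ} (hv : Measurable v) :
        Measurable fun a => Fin.tail (v a) := by
      unfold Fin.tail
      fun_prop
    unfold _root_.heatChain
    exact Measurable.mul (by fun_prop) (ih (by fun_prop) (by fun_prop) (htail hu) (htail hw))

lemma heatChain_succ_eq_prod (s y : ℝ) (m : ℕ) (r z : ℝ) (u w : Fin (m + 1) → ℝ) :
    heatChain s y (m + 1) r z u w =
      heatKernel (r - u 0) (z - w 0) ^ 2 *
        (∏ i : Fin m, heatKernel (u i.castSucc - u i.succ) (w i.castSucc - w i.succ) ^ 2) *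
        heatKernel (u (Fin.last m) - s) (w (Fin.last m) - y) ^ 2 := by
  induction m generalizing r z with
  | zero => simp [heatChain]
  | succ m ih =>
    rw [heatChain, ih, Fin.prod_univ_succ]
    simp only [Fin.tail, Fin.succ_last, Fin.castSucc_zero, Fin.succ_castSucc]
    ring

/-- Tonelli's theorem, separating the first coordinate. -/
lemma lintegral_fin_succ {n : ℕ} {f : (Fin (n + 1) → ℝ) → ℝ≥0∞} (hf : Measurable f) :
    ∫⁻ u, f u = ∫⁻ x : ℝ, ∫⁻ v : Fin n → ℝ, f (Fin.cons x v) := by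
  have hmp := (volume_preserving_piFinSuccAbove (fun _ : Fin (n + 1) => ℝ) 0).symm
  rw [← hmp.lintegral_comp_emb (MeasurableEquiv.measurableEmbedding _), Measure.volume_eq_prod,
    lintegral_prod (fun p => f _) (hf.comp (MeasurableEquiv.measurable _)).aemeasurable]
  simp [MeasurableEquiv.piFinSuccAbove_symm_apply, Fin.insertNthEquiv, Fin.insertNth_zero']

@[fun_prop]
lemma measurable_finCons {α : Type*} [MeasurableSpace α] {n : ℕ} {f : α → ℝ} {g : α → Fin n → ℝ}
    (hf : Measurable f) (hg : Measurable g) :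
    Measurable fun a => (Fin.cons (f a) (g a) : Fin (n + 1) → ℝ) := by
  refine measurable_pi_lambda _ fun i => ?_
  cases i using Fin.cases with
  | zero => simpa using hf
  | succ i => simpa [Function.comp_def] using (measurable_pi_apply i).comp hg

lemma measurable_lintegral_heatChain (s y : ℝ) (n : ℕ) (r z : ℝ) :
    Measurable fun u => ∫⁻ w, ENNReal.ofReal (heatChain s y n r z u w) :=
  Measurable.lintegral_prod_right' (f := fun p : _ × _ =>
    ENNReal.ofReal (heatChain s y n r z p.1 p.2)) (by fun_prop)

lemma lintegral_heatChain_succ (s y : ℝ) (n : ℕ) (r z : ℝ) :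
    ∫⁻ u, ∫⁻ w, ENNReal.ofReal (heatChain s y (n + 1) r z u w) =
      ∫⁻ x : ℝ, ∫⁻ v : ℝ, ENNReal.ofReal (heatKernel (r - x) (z - v) ^ 2) *
        ∫⁻ u, ∫⁻ w, ENNReal.ofReal (heatChain s y n x v u w) := by
  rw [lintegral_fin_succ (measurable_lintegral_heatChain s y (n + 1) r z)]
  refine lintegral_congr fun x => ?_
  simp_rw [fun u : Fin n → ℝ => lintegral_fin_succ (f := fun w =>
    ENNReal.ofReal (heatChain s y (n + 1) r z (Fin.cons x u) w)) (by fun_prop)]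
  rw [lintegral_lintegral_swap]
  · refine lintegral_congr fun v => ?_
    simp only [heatChain, Fin.cons_zero, Fin.tail_cons, ENNReal.ofReal_mul (sq_nonneg _)]
    rw [← lintegral_const_mul _ (measurable_lintegral_heatChain s y n x v)]
    refine lintegral_congr fun u => ?_
    rw [lintegral_const_mul _ (by fun_prop)]
  · refine Measurable.aemeasurable ?_
    exact Measurable.lintegral_prod_right' (f := fun p : ((Fin n → ℝ) × ℝ) × (Fin n → ℝ) =>
      ENNReal.ofReal (heatChain s y (n + 1) r z (Fin.cons x p.1.1) (Fin.cons p.1.2 p.2)))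
      (by fun_prop)

/-- The constant in the iterated convolution identity. -/
noncomputable def heatChainConst (n : ℕ) : ℝ := (2 ^ (n + 1) * Real.Gamma (((n : ℝ) + 1) / 2))⁻¹

lemma heatChainConst_pos (n : ℕ) : 0 < heatChainConst n := by
  have : 0 < Real.Gamma (((n : ℝ) + 1) / 2) := Real.Gamma_pos_of_pos (by positivity)
  unfold heatChainConst
  positivity

lemma heatChainConst_succ (n : ℕ) :
    (2 * √Real.pi)⁻¹ * heatChainConst n * ProbabilityTheory.beta (((n : ℝ) + 1) / 2) (1 / 2) =
      heatChainConst (n + 1) := by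
  have hG : 0 < Real.Gamma (((n : ℝ) + 1) / 2) := Real.Gamma_pos_of_pos (by positivity)
  have hG' : 0 < Real.Gamma (((n : ℝ) + 1 + 1) / 2) := Real.Gamma_pos_of_pos (by positivity)
  have hpi : 0 < √Real.pi := Real.sqrt_pos.2 Real.pi_pos
  rw [ProbabilityTheory.beta, Real.Gamma_one_half_eq,
    show ((n : ℝ) + 1) / 2 + 1 / 2 = ((n : ℝ) + 1 + 1) / 2 by ring]
  unfold heatChainConst
  push_cast
  field_simp
  ring

lemma lintegral_heatKernel_sq_mul {s x r : ℝ} (hsx : s < x) (hxr : x < r) {c : ℝ} (hc : 0 ≤ c)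
    (y z : ℝ) :
    ∫⁻ v, ENNReal.ofReal (heatKernel (r - x) (z - v) ^ 2) *
        ENNReal.ofReal (c * heatKernel ((x - s) / 2) (v - y)) =
      ENNReal.ofReal ((2 * √Real.pi)⁻¹ * (r - x) ^ (-(1 / 2) : ℝ) * c *
        heatKernel ((r - s) / 2) (z - y)) := by
  have hrx : 0 < r - x := sub_pos.2 hxr
  have hxs : 0 < x - s := sub_pos.2 hsx
  have hcoef : 0 ≤ (2 * √Real.pi)⁻¹ * (r - x) ^ (-(1 / 2) : ℝ) * c := by positivity
  rw [ENNReal.ofReal_mul hcoef, show (r - s) / 2 = (r - x) / 2 + (x - s) / 2 by ring,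
    ← lintegral_heatKernel_mul_heatKernel (half_pos hrx) (half_pos hxs),
    ← lintegral_const_mul _ (by fun_prop)]
  refine lintegral_congr fun v => ?_
  rw [← ENNReal.ofReal_mul (sq_nonneg _), ← ENNReal.ofReal_mul hcoef, heatKernel_sq hrx]
  congr 1
  ring

theorem lintegral_heatChain (s y : ℝ) (n : ℕ) (r z : ℝ) :
    ∫⁻ u, ∫⁻ w, ENNReal.ofReal (heatChain s y n r z u w) =
      ENNReal.ofReal (heatChainConst n * (r - s) ^ (((n : ℝ) - 1) / 2) *
        heatKernel ((r - s) / 2) (z - y)) := by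
  induction n generalizing r z with
  | zero =>
    simp only [heatChain, lintegral_const, volume_pi, Measure.pi_univ, Finset.univ_eq_empty,
      Finset.prod_empty, mul_one]
    congr 1
    rcases le_or_gt r s with h | h
    · rw [heatKernel_of_nonpos (by linarith), heatKernel_of_nonpos (by linarith)]
      simp
    · rw [heatKernel_sq (sub_pos.2 h), heatChainConst]
      norm_num [Real.Gamma_one_half_eq]
  | succ n ih =>
    rw [lintegral_heatChain_succ]
    simp_rw [ih]
    rcases le_or_gt r s with h | h
    · rw [heatKernel_of_nonpos (t := (r - s) / 2) (by linarith), mul_zero, ENNReal.ofReal_zero]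
      refine lintegral_eq_zero_of_ae_eq_zero (ae_of_all _ fun x =>
        lintegral_eq_zero_of_ae_eq_zero (ae_of_all _ fun v => ?_))
      rcases le_or_gt r x with hx | hx
      · simp [heatKernel_of_nonpos (t := r - x) (by linarith)]
      · simp [heatKernel_of_nonpos (t := (x - s) / 2) (by linarith)]
    · have hconst := heatChainConst_pos n
      have hk := heatKernel_nonneg ((r - s) / 2) (z - y)
      set a : ℝ := ((n : ℝ) + 1) / 2 with ha
      have ha0 : 0 < a := by positivity
      have hcoef : 0 ≤ (2 * √Real.pi)⁻¹ * heatChainConst n * heatKernel ((r - s) / 2) (z - y) := by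
        positivity
      calc
        _ = ∫⁻ x, (Set.Ioo s r).indicator (fun x =>
              ENNReal.ofReal
                ((2 * √Real.pi)⁻¹ * heatChainConst n * heatKernel ((r - s) / 2) (z - y)) *
              ENNReal.ofReal ((x - s) ^ (a - 1) * (r - x) ^ ((1 / 2 : ℝ) - 1))) x := by
          refine lintegral_congr fun x => ?_
          by_cases hx : x ∈ Set.Ioo s r
          · have hxs : 0 < x - s := sub_pos.2 hx.1
            rw [Set.indicator_of_mem hx, lintegral_heatKernel_sq_mul hx.1 hx.2 (by positivity),
              ← ENNReal.ofReal_mul hcoef, show ((n : ℝ) - 1) / 2 = a - 1 by rw [ha]; ring,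
              show (1 / 2 : ℝ) - 1 = -(1 / 2) by norm_num]
            congr 1
            ring
          · rw [Set.indicator_of_notMem hx]
            refine lintegral_eq_zero_of_ae_eq_zero (ae_of_all _ fun v => ?_)
            rcases le_or_gt x s with hxs | hxs
            · simp [heatKernel_of_nonpos (t := (x - s) / 2) (by linarith)]
            · have hrx : r ≤ x := not_lt.1 fun hxr => hx ⟨hxs, hxr⟩
              simp [heatKernel_of_nonpos (t := r - x) (by linarith)]
        _ = _ := by
          rw [lintegral_indicator measurableSet_Ioo, lintegral_const_mul _ (by fun_prop),
            lintegral_rpow_mul_rpow ha0 (by norm_num) h, ← ENNReal.ofReal_mul hcoef,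
            ← heatChainConst_succ, show a + 1 / 2 - 1 = (((n + 1 : ℕ) : ℝ) - 1) / 2 by
              rw [ha]; push_cast; ring]
          congr 1
          ring

lemma integral_integral_heatChain (s y : ℝ) (n : ℕ) (r z : ℝ) (hsr : s < r) :
    ∫ u, ∫ w, heatChain s y n r z u w =
      heatChainConst n * (r - s) ^ (((n : ℝ) - 1) / 2) * heatKernel ((r - s) / 2) (z - y) := by
  have hmeas := measurable_lintegral_heatChain s y n r z
  have hinner (u : Fin n → ℝ) : ∫ w, heatChain s y n r z u w =
      (∫⁻ w, ENNReal.ofReal (heatChain s y n r z u w)).toReal :=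
    integral_eq_lintegral_of_nonneg_ae (ae_of_all _ fun w => heatChain_nonneg _ _ _ _ _ _ _)
      (by fun_prop : Measurable fun w => heatChain s y n r z u w).aestronglyMeasurable
  have hconst := heatChainConst_pos n
  have hk := heatKernel_nonneg ((r - s) / 2) (z - y)
  have hd : 0 < r - s := sub_pos.2 hsr
  simp_rw [hinner]
  rw [integral_toReal hmeas.aemeasurable (ae_lt_top hmeas (by simp [lintegral_heatChain])),
    lintegral_heatChain, ENNReal.toReal_ofReal (by positivity)]

/-- The iterated convolution identity for squared heat kernels from the proof of
Lemma 5.1. Here `n = m + 1` ranges over all integers `n ≥ 1`, `u i` represents the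
time `r_{i+1}` and `w i` the space variable `z_{i+1}`:
`∫_{s<r_n<⋯<r_1<r} ∫_{ℝⁿ} p_{r-r_1}(z-z_1)² ⋯ p_{r_n-s}(z_n-y)² dz dr
  = ((r-s)^{(n-1)/2} / (2^{n+1} Γ((n+1)/2))) p_{(r-s)/2}(z-y)`. -/
theorem iterated_heat_kernel_identity (m : ℕ) (s r y z : ℝ) (hs : 0 ≤ s) (hsr : s < r) :
    (∫ u in {u : Fin (m + 1) → ℝ |
        s < u (Fin.last m) ∧ u 0 < r ∧ ∀ i : Fin m, u i.succ < u i.castSucc},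
      ∫ w : Fin (m + 1) → ℝ,
        (heatKernel (r - u 0) (z - w 0)) ^ 2 *
          (∏ i : Fin m, (heatKernel (u i.castSucc - u i.succ) (w i.castSucc - w i.succ)) ^ 2) *
          (heatKernel (u (Fin.last m) - s) (w (Fin.last m) - y)) ^ 2)
      = ((r - s) ^ ((((m + 1 : ℕ) : ℝ) - 1) / 2) /
          (2 ^ ((m + 1) + 1) * Real.Gamma ((((m + 1 : ℕ) : ℝ) + 1) / 2))) *
          heatKernel ((r - s) / 2) (z - y) := by
  have hzero (u : Fin (m + 1) → ℝ) (hu : u ∉ {u : Fin (m + 1) → ℝ |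
      s < u (Fin.last m) ∧ u 0 < r ∧ ∀ i : Fin m, u i.succ < u i.castSucc})
      (w : Fin (m + 1) → ℝ) : heatChain s y (m + 1) r z u w = 0 := by
    rw [heatChain_succ_eq_prod]
    by_contra hne
    obtain ⟨hne', hlast⟩ := mul_ne_zero_iff.1 hne
    obtain ⟨hfirst, hprod⟩ := mul_ne_zero_iff.1 hne'
    have hpos {t x : ℝ} (h : heatKernel t x ^ 2 ≠ 0) : 0 < t := by
      by_contra! ht
      simp [heatKernel_of_nonpos ht] at h
    exact hu ⟨sub_pos.1 (hpos hlast), sub_pos.1 (hpos hfirst),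
      fun i => sub_pos.1 (hpos (Finset.prod_ne_zero_iff.1 hprod i (Finset.mem_univ i)))⟩
  simp_rw [← heatChain_succ_eq_prod]
  rw [setIntegral_eq_integral_of_forall_compl_eq_zero fun u hu => by simp [hzero u hu],
    integral_integral_heatChain s y (m + 1) r z hsr, heatChainConst]
  ring
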